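/- Let m > 0 and let u be a nonzero smooth compactly supported real-valued function on ℝ³. Then H u = 𝓕⁻¹(ω_m · 𝓕u) does not have compact support. (Localized Cauchy data are mapped by the complex structure J outside the local subspace: the standard local subspaces S(G) are real-linear but not complex-linear.) -/

import Mathlib

open MeasureTheory Complex FourierTransform
open scoped SchwartzMap

noncomputable section

/-- Physical space `ℝ³`. -/
abbrev E3 : Type := EuclideanSpace ℝ (Fin 3)

/-- The relativistic dispersion symbol `ω_m(ξ) = √(‖ξ‖² + m²)`. -/
def omegam (m : ℝ) (ξ : E3) : ℝ := Real.sqrt (‖ξ‖ ^ 2 + m ^ 2)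

/-- The operator `H^s = (−∇² + m²)^{s/2}`, acting as the Fourier multiplier with symbol
`ω_m^s`: `H^s u = 𝓕⁻¹(ω_m^s · 𝓕u)`. -/
def Hpow (m s : ℝ) (u : E3 → ℂ) : E3 → ℂ :=
  𝓕⁻ (fun ξ => ((omegam m ξ ^ s : ℝ) : ℂ) * 𝓕 u ξ)

/-- The restriction to a line through the origin of the Fourier transform of a continuous
compactly supported function extends to an entire function. -/
lemma exists_entire_extension_fourier_line {V : Type*} [NormedAddCommGroup V]
    [InnerProductSpace ℝ V] [MeasurableSpace V] [BorelSpace V] [FiniteDimensional ℝ V]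
    {f : V → ℂ} (hf : Continuous f) (hs : HasCompactSupport f) (e : V) :
    ∃ G : ℂ → ℂ, Differentiable ℂ G ∧ ∀ t : ℝ, G t = 𝓕 f (t • e) := by
  have hint : Integrable f := hf.integrable_of_hasCompactSupport hs
  obtain ⟨R, hR⟩ := hs.isCompact.isBounded.exists_norm_le
  let c : V → ℂ := fun x => -2 * Real.pi * I * (inner ℝ x e : ℝ)
  have hc : Continuous c := by fun_prop
  have hcR : ∀ x, f x ≠ 0 → ‖c x‖ ≤ 2 * Real.pi * (R * ‖e‖) := fun x hx => by
    have h1 : |inner ℝ x e| ≤ R * ‖e‖ := (abs_real_inner_le_norm x e).trans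
      (mul_le_mul_of_nonneg_right (hR x (subset_tsupport f hx)) (norm_nonneg e))
    have h2 : ‖c x‖ = 2 * Real.pi * |inner ℝ x e| := by
      simp [c, abs_of_pos Real.pi_pos]
    rw [h2]
    gcongr
  refine ⟨fun z => ∫ x, cexp (z * c x) * f x, fun z₀ => ?_, fun t => ?_⟩
  · have hcont : ∀ z, Continuous fun x => cexp (z * c x) * f x := fun z => by fun_prop
    refine (hasDerivAt_integral_of_dominated_loc_of_deriv_le
      (F := fun z x => cexp (z * c x) * f x)
      (F' := fun z x => cexp (z * c x) * c x * f x)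
      (bound := fun x => Real.exp ((‖z₀‖ + 1) * (2 * Real.pi * (R * ‖e‖))) *
        (2 * Real.pi * (R * ‖e‖)) * ‖f x‖)
      (Metric.ball_mem_nhds z₀ one_pos) ?_ ?_ ?_ ?_ ?_ ?_).2.differentiableAt
    · exact .of_forall fun z => (hcont z).aestronglyMeasurable
    · exact (hcont z₀).integrable_of_hasCompactSupport hs.mul_left
    · exact Continuous.aestronglyMeasurable (by fun_prop)
    · refine .of_forall fun x z hz => ?_
      by_cases hx : f x = 0
      · simp [hx]
      have hz' : ‖z‖ ≤ ‖z₀‖ + 1 := by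
        have h1 := norm_sub_norm_le z z₀
        rw [Metric.mem_ball, dist_eq_norm] at hz
        linarith
      have hcx := hcR x hx
      rw [norm_mul, norm_mul]
      gcongr
      refine (norm_exp_le_exp_norm _).trans ?_
      rw [norm_mul]
      gcongr
    · exact hint.norm.const_mul _
    · refine .of_forall fun x z _ => ?_
      simpa using (((hasDerivAt_id z).mul_const (c x)).cexp).mul_const (f x)
  · rw [Real.fourier_eq']
    refine integral_congr_ae (.of_forall fun x => ?_)
    simp only [smul_eq_mul, c, inner_smul_right]
    congr 2
    push_cast
    ring

/-- If `g`, `h` are entire and `h² = (a² t² + b²) g²` on the real line with `a, b > 0`, then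
`g = 0`: otherwise the two sides vanish to orders of different parity at `i b / a`. -/
lemma eq_zero_of_sq_eq_quadratic_mul_sq {g h : ℂ → ℂ} (hg : Differentiable ℂ g)
    (hh : Differentiable ℂ h) {a b : ℝ} (ha : 0 < a) (hb : 0 < b)
    (H : ∀ t : ℝ, h t ^ 2 = (a ^ 2 * t ^ 2 + b ^ 2) * g t ^ 2) : g = 0 := by
  have hgA : AnalyticOnNhd ℂ g Set.univ := fun z _ => hg.analyticAt z
  have hfreq : ∃ᶠ z in nhdsWithin (0 : ℂ) {0}ᶜ,
      h z ^ 2 = (a ^ 2 * z ^ 2 + b ^ 2) * g z ^ 2 := by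
    have ht : Filter.Tendsto (fun t : ℝ => (t : ℂ)) (nhdsWithin 0 {0}ᶜ)
        (nhdsWithin (0 : ℂ) {0}ᶜ) := by
      refine tendsto_nhdsWithin_iff.2 ⟨?_, ?_⟩
      · exact (Complex.continuous_ofReal.tendsto' 0 0 (by simp)).mono_left nhdsWithin_le_nhds
      · filter_upwards [self_mem_nhdsWithin] with t ht
        simpa using ht
    exact ht.frequently (Filter.Eventually.of_forall H).frequently
  have hEq : (fun z => h z ^ 2) = fun z : ℂ => (a ^ 2 * z ^ 2 + b ^ 2) * g z ^ 2 :=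
    AnalyticOnNhd.eq_of_frequently_eq
      (fun z _ => Differentiable.analyticAt (by fun_prop) z)
      (fun z _ => Differentiable.analyticAt (by fun_prop) z) hfreq
  have ha' : (a : ℂ) ≠ 0 := by exact_mod_cast ha.ne'
  have hb' : (b : ℂ) ≠ 0 := by exact_mod_cast hb.ne'
  let z₀ : ℂ := b / a * I
  have hq : analyticOrderAt (fun z : ℂ => (a : ℂ) ^ 2 * z ^ 2 + b ^ 2) z₀ = (1 : ℕ) := by
    rw [AnalyticAt.analyticOrderAt_eq_natCast (Differentiable.analyticAt (by fun_prop) _)]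
    refine ⟨fun z => a ^ 2 * (z + z₀), Differentiable.analyticAt (by fun_prop) _, ?_,
      .of_forall fun z => ?_⟩
    · have : (a : ℂ) ^ 2 * (z₀ + z₀) = 2 * a * b * I := by
        simp only [z₀]; field_simp; ring
      simp [this, ha', hb']
    · have : (a : ℂ) ^ 2 * z₀ ^ 2 = - b ^ 2 := by
        simp only [z₀, mul_pow, I_sq]; field_simp
      simp only [smul_eq_mul, pow_one]
      linear_combination this
  have hord := congrArg (analyticOrderAt · z₀) hEq
  have hsq : ∀ k : ℂ → ℂ, Differentiable ℂ k →
      analyticOrderAt (fun z => k z ^ 2) z₀ = 2 • analyticOrderAt k z₀ :=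
    fun k hk => analyticOrderAt_pow (hk.analyticAt z₀) 2
  have hmul : analyticOrderAt (fun z : ℂ => (a ^ 2 * z ^ 2 + b ^ 2) * g z ^ 2) z₀ =
      (1 : ℕ) + 2 • analyticOrderAt g z₀ := by
    rw [← hq, ← hsq g hg]
    exact analyticOrderAt_mul (Differentiable.analyticAt (by fun_prop) z₀)
      (Differentiable.analyticAt (by fun_prop) z₀)
  simp only [hmul, hsq h hh] at hord
  by_cases hgt : analyticOrderAt g z₀ = ⊤
  · exact hgA.eq_of_eventuallyEq (fun z _ => analyticAt_const) (analyticOrderAt_eq_top.1 hgt)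
  · exfalso
    obtain ⟨n, hn⟩ := ENat.ne_top_iff_exists.1 hgt
    rw [← hn] at hord
    by_cases hht : analyticOrderAt h z₀ = ⊤
    · rw [hht, nsmul_eq_mul, nsmul_eq_mul] at hord
      have : ((1 + 2 * n : ℕ) : ℕ∞) = ⊤ := by
        push_cast
        exact_mod_cast hord.symm.trans (by simp)
      exact ENat.natCast_ne_top _ this
    · obtain ⟨k, hk⟩ := ENat.ne_top_iff_exists.1 hht
      rw [← hk, nsmul_eq_mul, nsmul_eq_mul] at hord
      have : 2 * k = 1 + 2 * n := by exact_mod_cast hord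
      omega

lemma continuous_omegam (m : ℝ) : Continuous (omegam m) := by
  unfold omegam
  fun_prop

lemma omegam_nonneg (m : ℝ) (ξ : E3) : 0 ≤ omegam m ξ := Real.sqrt_nonneg _

lemma omegam_sq (m : ℝ) (ξ : E3) : omegam m ξ ^ 2 = ‖ξ‖ ^ 2 + m ^ 2 :=
  Real.sq_sqrt (by positivity)

lemma omegam_le {m : ℝ} (hm : 0 ≤ m) (ξ : E3) : omegam m ξ ≤ ‖ξ‖ + m := by
  refine Real.sqrt_le_iff.2 ⟨by positivity, ?_⟩
  nlinarith [norm_nonneg ξ, mul_nonneg (norm_nonneg ξ) hm]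

lemma integrable_omegam_mul {m : ℝ} (hm : 0 ≤ m) (f : 𝓢(E3, ℂ)) :
    Integrable fun ξ => (omegam m ξ : ℂ) * f ξ := by
  have h1 : Integrable fun ξ : E3 => ‖ξ‖ ^ 1 * ‖f ξ‖ + m * ‖f ξ‖ :=
    (f.integrable_pow_mul volume 1).add (f.integrable.norm.const_mul m)
  refine h1.mono' ?_ (.of_forall fun ξ => ?_)
  · have := continuous_omegam m
    have := f.continuous
    exact Continuous.aestronglyMeasurable (by fun_prop)
  · rw [norm_mul, norm_real, Real.norm_of_nonneg (omegam_nonneg m ξ), pow_one, ← add_mul]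
    exact mul_le_mul_of_nonneg_right (omegam_le hm ξ) (norm_nonneg _)

/-- for `m > 0` and `u` a nonzero smooth compactly supported real-valued
function on `ℝ³`, `H u = 𝓕⁻¹(ω_m · 𝓕u)` does not have compact support. -/
theorem Hu_not_compactly_supported (m : ℝ) (hm : 0 < m)
    (u : E3 → ℝ) (hu_smooth : ContDiff ℝ (⊤ : ℕ∞) u) (hu_supp : HasCompactSupport u)
    (hu_ne : u ≠ 0) :
    ¬ HasCompactSupport (Hpow m 1 (fun x => (u x : ℂ))) := by
  intro hv
  have hU_supp : HasCompactSupport fun x => (u x : ℂ) :=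
    hu_supp.comp_left (g := fun r : ℝ => (r : ℂ)) ofReal_zero
  have hU_smooth : ContDiff ℝ (⊤ : ℕ∞) fun x => (u x : ℂ) := ofRealCLM.contDiff.comp hu_smooth
  let U : 𝓢(E3, ℂ) := hU_supp.toSchwartzMap hU_smooth
  have hU : (fun x => (u x : ℂ)) = U := rfl
  set w : E3 → ℂ := fun ξ => (omegam m ξ : ℂ) * 𝓕 U ξ with hw
  have hHw : Hpow m 1 (fun x => (u x : ℂ)) = 𝓕⁻ w := by
    simp only [Hpow, Real.rpow_one, hU, hw, SchwartzMap.fourier_coe]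
  rw [hHw] at hv
  have hw_int : Integrable w := integrable_omegam_mul hm.le (𝓕 U)
  have hw_cont : Continuous w := by
    have := continuous_omegam m
    have := (𝓕 U).continuous
    fun_prop
  have hFw_cont : Continuous (𝓕 w) :=
    VectorFourier.fourierIntegral_continuous Real.continuous_fourierChar continuous_inner hw_int
  have hFw : 𝓕⁻ w = fun x => 𝓕 w (-x) := funext (Real.fourierInv_eq_fourier_neg w)
  have hv_cont : Continuous (𝓕⁻ w) := by rw [hFw]; fun_prop
  have hFw_int : Integrable (𝓕 w) := by
    have := hv_cont.integrable_of_hasCompactSupport (μ := volume) hv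
    rw [hFw] at this
    simpa using this.comp_neg
  have hinv : 𝓕 (𝓕⁻ w) = w := hw_cont.fourier_fourierInv_eq hw_int hFw_int
  obtain ⟨b, hb⟩ : ∃ b, 𝓕 U b ≠ 0 := by
    by_contra! h
    have h0 : 𝓕 U = 0 := SchwartzMap.ext h
    have hU0 : U = 0 := by
      rw [← fourierInv_fourier_eq (F := 𝓢(E3, ℂ)) U, h0]
      exact map_zero (fourierInvCLM ℂ 𝓢(E3, ℂ))
    refine hu_ne (funext fun x => ?_)
    have : (u x : ℂ) = 0 := DFunLike.congr_fun hU0 x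
    exact_mod_cast this
  obtain ⟨e, he, t, ht⟩ : ∃ e : E3, e ≠ 0 ∧ ∃ t : ℝ, 𝓕 U (t • e) ≠ 0 := by
    by_cases hb0 : b = 0
    · obtain ⟨e, he⟩ := exists_ne (0 : E3)
      exact ⟨e, he, 0, by simpa [hb0] using hb⟩
    · exact ⟨b, hb0, 1, by simpa using hb⟩
  obtain ⟨g, hg, hg'⟩ := exists_entire_extension_fourier_line U.continuous hU_supp e
  obtain ⟨h, hh, hh'⟩ := exists_entire_extension_fourier_line hv_cont hv e
  have hg0 : g = 0 := by
    refine eq_zero_of_sq_eq_quadratic_mul_sq hg hh (norm_pos_iff.2 he) hm fun s => ?_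
    rw [hg', hh', hinv, ← SchwartzMap.fourier_coe]
    have hom := omegam_sq m (s • e)
    rw [norm_smul, mul_pow, Real.norm_eq_abs, sq_abs] at hom
    have hom' : (omegam m (s • e) : ℂ) ^ 2 = s ^ 2 * ‖e‖ ^ 2 + m ^ 2 := by exact_mod_cast hom
    simp only [hw]
    linear_combination (𝓕 U (s • e)) ^ 2 * hom'
  apply ht
  rw [SchwartzMap.fourier_coe, ← hg' t, hg0, Pi.zero_apply]

end
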